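/- Let H be a finite simple graph. If the class Excl(H) of all finite simple graphs not containing H as an induced minor is well-quasi-ordered by the induced minor relation, then H is an induced minor of K̂₄ or H is an induced minor of the gem. -/

import Mathlib

open SimpleGraph

namespace IMWQO

/-- `H` is an induced minor of `G`: there is a family of pairwise disjoint nonempty
connected subsets of `V(G)`, indexed by `V(H)`, such that distinct branch sets are
joined by an edge of `G` iff the corresponding vertices are adjacent in `H`. -/
def IsInducedMinor {α β : Type*} (H : SimpleGraph α) (G : SimpleGraph β) : Prop :=
  ∃ μ : α → Set β,
    (∀ a, (μ a).Nonempty) ∧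
    (∀ a b, a ≠ b → Disjoint (μ a) (μ b)) ∧
    (∀ a, (G.induce (μ a)).Connected) ∧
    (∀ a b, a ≠ b → ((∃ x ∈ μ a, ∃ y ∈ μ b, G.Adj x y) ↔ H.Adj a b))

/-- A bundled finite simple graph. -/
abbrev FinGraph := Σ n : ℕ, SimpleGraph (Fin n)

/-- The induced minor relation on bundled finite graphs. -/
def FinGraph.IM (H G : FinGraph) : Prop := IsInducedMinor H.2 G.2

/-- A class of finite graphs is well-quasi-ordered by the induced minor relation. -/
def WqoClass (P : FinGraph → Prop) : Prop :=
  ∀ f : ℕ → FinGraph, (∀ i, P (f i)) → ∃ i j, i < j ∧ FinGraph.IM (f i) (f j)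

/-- `K̂₄`: `K₄` (on vertices `0,1,2,3`) plus a vertex `4` adjacent to `0` and `1`. -/
def hatK4 : SimpleGraph (Fin 5) :=
  SimpleGraph.fromRel fun a b =>
    (a.val < 4 ∧ b.val < 4) ∨ (a.val = 4 ∧ (b.val = 0 ∨ b.val = 1))

/-- The gem: the path `0 - 1 - 2 - 3` plus a dominating vertex `4`. -/
def gem : SimpleGraph (Fin 5) :=
  SimpleGraph.fromRel fun a b =>
    (b.val = a.val + 1 ∧ b.val ≤ 3) ∨ a.val = 4

/-- The complete graph on four vertices. -/
def K4 : SimpleGraph (Fin 4) := ⊤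

/-- The prism, i.e. the Cartesian (box) product `K₃ □ K₂`. -/
def prism : SimpleGraph (Fin 3 × Fin 2) :=
  (⊤ : SimpleGraph (Fin 3)) □ (⊤ : SimpleGraph (Fin 2))

/-- The complete bipartite graph `K_{3,3}`. -/
def K33 : SimpleGraph (Fin 3 ⊕ Fin 3) := completeBipartiteGraph (Fin 3) (Fin 3)

/-- Subdivide the edge `{u,v}` of `G`, the new vertex being `Fin.last n`. -/
def subdivideEdge {n : ℕ} (G : SimpleGraph (Fin n)) (u v : Fin n) :
    SimpleGraph (Fin (n + 1)) :=
  SimpleGraph.fromRel fun a b =>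
    (∃ a' b' : Fin n, a = a'.castSucc ∧ b = b'.castSucc ∧ G.Adj a' b' ∧
      ¬(a' = u ∧ b' = v) ∧ ¬(a' = v ∧ b' = u))
    ∨ (a = Fin.last n ∧ (b = u.castSucc ∨ b = v.castSucc))

/-- One subdivision step on bundled graphs: the first graph is obtained from the
second one by subdividing one edge. -/
inductive SubdivStep : FinGraph → FinGraph → Prop
  | mk {n : ℕ} (G : SimpleGraph (Fin n)) (u v : Fin n) (h : G.Adj u v) :
      SubdivStep ⟨n + 1, subdivideEdge G u v⟩ ⟨n, G⟩

/-- `G` is (isomorphic to) a subdivision of `H`. -/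
def IsSubdivision {α β : Type*} (G : SimpleGraph α) (H : SimpleGraph β) : Prop :=
  ∃ A B : FinGraph, Nonempty (G ≃g A.2) ∧ Nonempty (H ≃g B.2) ∧
    Relation.ReflTransGen SubdivStep A B

/-- `G` contains a subdivision of `H` as a subgraph. -/
def ContainsSubdivAsSubgraph {α β : Type*} (G : SimpleGraph α) (H : SimpleGraph β) : Prop :=
  ∃ S : G.Subgraph, IsSubdivision S.coe H

/-- `G` has a proper `K₄`-subdivision: for some vertex `v`, `G - v` contains
a subdivision of `K₄` as a subgraph. -/
def HasProperK4Subdivision {α : Type*} (G : SimpleGraph α) : Prop :=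
  ∃ v : α, ContainsSubdivAsSubgraph (G.induce {u | u ≠ v}) K4

/-- `G` is 2-connected: at least 3 vertices, and removing any vertex leaves it connected. -/
def TwoConnected {α : Type*} [Fintype α] (G : SimpleGraph α) : Prop :=
  3 ≤ Fintype.card α ∧ ∀ v : α, (G.induce {u | u ≠ v}).Connected

/-- `G` is complete multipartite: two vertices are adjacent iff they lie in different
classes of some partition (equivalence relation). -/
def IsCompleteMultipartite {α : Type*} (G : SimpleGraph α) : Prop :=
  ∃ s : Setoid α, ∀ u v, G.Adj u v ↔ ¬ s.r u v

/-- `G` is a cograph: it has no induced path on four vertices. -/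
def IsCograph {α : Type*} (G : SimpleGraph α) : Prop :=
  ∀ f : Fin 4 → α, Function.Injective f →
    ¬ (∀ a b : Fin 4, G.Adj (f a) (f b) ↔ (pathGraph 4).Adj a b)

/-- `G` is a linear forest: acyclic with maximum degree at most 2,
i.e. a disjoint union of paths. -/
def IsLinearForest {α : Type*} (G : SimpleGraph α) : Prop :=
  G.IsAcyclic ∧ ∀ v, (G.neighborSet v).ncard ≤ 2

/-- The set `C` induces an (induced) cycle in `G`. -/
def InducesCycle {α : Type*} (G : SimpleGraph α) (C : Set α) : Prop :=
  ∃ n : ℕ, 3 ≤ n ∧ Nonempty ((G.induce C) ≃g cycleGraph n)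

/-- The set `S` induces a path in `G` all of whose internal vertices have degree two
in `G`. -/
def IsBasicPath {α : Type*} (G : SimpleGraph α) (S : Set α) : Prop :=
  ∃ (n : ℕ) (φ : (G.induce S) ≃g pathGraph n),
    ∀ v : S, (φ v).val ≠ 0 → (φ v).val ≠ n - 1 → (G.neighborSet v.val).ncard = 2

/-- The wheel with cycle `0, …, n-1` and center adjacent to the vertices of `T`. -/
def wheelGraph (n : ℕ) (T : Finset (Fin n)) : SimpleGraph (Fin n ⊕ Unit) :=
  SimpleGraph.fromRel fun a b =>
    (∃ x y : Fin n, a = Sum.inl x ∧ b = Sum.inl y ∧ (cycleGraph n).Adj x y)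
    ∨ (∃ x ∈ T, a = Sum.inr () ∧ b = Sum.inl x)

/-- `G` is a `k`-wheel: a cycle of order at least `max k 3` plus a center adjacent to
exactly `k` distinct vertices of the cycle. -/
def IsWheel {α : Type*} (k : ℕ) (G : SimpleGraph α) : Prop :=
  ∃ n : ℕ, 3 ≤ n ∧ k ≤ n ∧ ∃ T : Finset (Fin n), T.card = k ∧
    Nonempty (G ≃g wheelGraph n T)

/-- A 3-wheel subgraph of `G`: a cycle of `G` together with a center outside the cycle
joined to (at least) three distinct vertices of the cycle by edges of `G`. -/
structure ThreeWheelSub {α : Type*} (G : SimpleGraph α) where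
  base : α
  cyc : G.Walk base base
  cyc_isCycle : cyc.IsCycle
  center : α
  center_not_mem : center ∉ cyc.support
  spokes : Finset α
  spokes_card : spokes.card = 3
  spokes_sub : ∀ x ∈ spokes, x ∈ cyc.support
  spokes_adj : ∀ x ∈ spokes, G.Adj center x

/-- The number of vertices of a 3-wheel subgraph. -/
def ThreeWheelSub.order {α : Type*} [DecidableEq α] {G : SimpleGraph α}
    (W : ThreeWheelSub G) : ℕ :=
  W.cyc.support.toFinset.card + 1

/-- `G` has a cycle-multipartite decomposition. -/
def HasCycleMultipartiteDecomp {α : Type*} (G : SimpleGraph α) : Prop :=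
  ∃ C R : Set α, C ∪ R = Set.univ ∧ Disjoint C R ∧
    InducesCycle G C ∧ IsCompleteMultipartite (G.induce R) ∧
    ∀ u ∈ R, ∀ v ∈ R, ∀ c ∈ C, (G.Adj u c ↔ G.Adj v c)

/-- A bundled finite simple graph whose vertices are labeled by finite subsets of `S`. -/
structure LabGraph (S : Type*) where
  n : ℕ
  graph : SimpleGraph (Fin n)
  label : Fin n → Finset S

/-- The domination order on finite subsets of a quasi-order: `A ≤^P B` iff there is an
injection `φ : A → B` with `r a (φ a)` for all `a ∈ A`. -/
def FinsetLE {S : Type*} (r : S → S → Prop) (A B : Finset S) : Prop :=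
  ∃ φ : {x // x ∈ A} → {x // x ∈ B}, Function.Injective φ ∧ ∀ a, r a.val (φ a).val

/-- The union of the labels of the vertices in `A`. -/
noncomputable def labelUnion {S : Type*} {n : ℕ} (lab : Fin n → Finset S)
    (A : Finset (Fin n)) : Finset S :=
  letI := Classical.decEq S
  A.biUnion lab

/-- Label-respecting induced minor relation on labeled graphs. -/
def LabIM {S : Type*} (r : S → S → Prop) (H G : LabGraph S) : Prop :=
  ∃ μ : Fin H.n → Finset (Fin G.n),
    (∀ a, (μ a).Nonempty) ∧
    (∀ a b, a ≠ b → Disjoint (μ a) (μ b)) ∧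
    (∀ a, (G.graph.induce (↑(μ a) : Set (Fin G.n))).Connected) ∧
    (∀ a b, a ≠ b → ((∃ x ∈ μ a, ∃ y ∈ μ b, G.graph.Adj x y) ↔ H.graph.Adj a b)) ∧
    (∀ a, FinsetLE r (H.label a) (labelUnion G.label (μ a)))

/-- Label-respecting contraction relation on labeled graphs: an induced minor model
whose branch sets cover all vertices. -/
def LabContraction {S : Type*} (r : S → S → Prop) (H G : LabGraph S) : Prop :=
  ∃ μ : Fin H.n → Finset (Fin G.n),
    (∀ a, (μ a).Nonempty) ∧
    (∀ a b, a ≠ b → Disjoint (μ a) (μ b)) ∧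
    (∀ x : Fin G.n, ∃ a, x ∈ μ a) ∧
    (∀ a, (G.graph.induce (↑(μ a) : Set (Fin G.n))).Connected) ∧
    (∀ a b, a ≠ b → ((∃ x ∈ μ a, ∃ y ∈ μ b, G.graph.Adj x y) ↔ H.graph.Adj a b)) ∧
    (∀ a, FinsetLE r (H.label a) (labelUnion G.label (μ a)))

/-- Label-respecting induced subgraph relation on labeled graphs. -/
def LabISub {S : Type*} (r : S → S → Prop) (H G : LabGraph S) : Prop :=
  ∃ φ : Fin H.n → Fin G.n, Function.Injective φ ∧
    (∀ a b, H.graph.Adj a b ↔ G.graph.Adj (φ a) (φ b)) ∧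
    (∀ a, FinsetLE r (H.label a) (G.label (φ a)))

/-- A relation is a well-quasi-order: every infinite sequence contains a good pair. -/
def IsWqo {S : Type*} (r : S → S → Prop) : Prop :=
  ∀ g : ℕ → S, ∃ i j, i < j ∧ r (g i) (g j)





/-- A subset `A` of the vertices is nonempty and connected, phrased through sets closed under
adjacency inside `A`. -/
def IsConn {V : Type*} (G : SimpleGraph V) (A : Set V) : Prop :=
  A.Nonempty ∧ ∀ S : Set V, (∃ x ∈ A, x ∈ S) →
    (∀ x ∈ A, x ∈ S → ∀ y ∈ A, G.Adj x y → y ∈ S) → A ⊆ S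

/-- There is an edge between `A` and `B`. -/
def Touch {V : Type*} (G : SimpleGraph V) (A B : Set V) : Prop :=
  ∃ x ∈ A, ∃ y ∈ B, G.Adj x y

section Basic

variable {V : Type*} {G : SimpleGraph V} {A B : Set V}

lemma isConn_of_connected (h : (G.induce A).Connected) : IsConn G A := by
  obtain ⟨a⟩ := h.nonempty
  refine ⟨⟨a, a.2⟩, ?_⟩
  rintro S ⟨x, hxA, hxS⟩ hS y hy
  obtain ⟨w⟩ := h.preconnected ⟨x, hxA⟩ ⟨y, hy⟩
  suffices H : ∀ (u v : A), (G.induce A).Walk u v → u.1 ∈ S → v.1 ∈ S from H _ _ w hxS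
  intro u v w
  induction w with
  | nil => exact id
  | @cons u v _ huv _ ih => exact fun hu => ih (hS u u.2 hu v v.2 huv)

lemma Touch.symm (h : Touch G A B) : Touch G B A := by
  obtain ⟨x, hx, y, hy, h⟩ := h
  exact ⟨y, hy, x, hx, h.symm⟩

lemma IsConn.union (hA : IsConn G A) (hB : IsConn G B) (h : Touch G A B) :
    IsConn G (A ∪ B) := by
  obtain ⟨a, ha, b, hb, hab⟩ := h
  refine ⟨hA.1.inl, ?_⟩
  rintro S ⟨x, hx, hxS⟩ hS
  have keyA : (∃ x ∈ A, x ∈ S) → A ⊆ S := fun h =>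
    hA.2 S h fun x hx hxS y hy => hS x (.inl hx) hxS y (.inl hy)
  have keyB : (∃ x ∈ B, x ∈ S) → B ⊆ S := fun h =>
    hB.2 S h fun x hx hxS y hy => hS x (.inr hx) hxS y (.inr hy)
  rcases hx with hx | hx
  · have h1 := keyA ⟨x, hx, hxS⟩
    exact Set.union_subset h1 (keyB ⟨b, hb, hS a (.inl ha) (h1 ha) b (.inr hb) hab⟩)
  · have h1 := keyB ⟨x, hx, hxS⟩
    exact Set.union_subset (keyA ⟨a, ha, hS b (.inr hb) (h1 hb) a (.inl ha) hab.symm⟩) h1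

/-- A connected set in which some vertex has no neighbour is a singleton. -/
lemma IsConn.eq_singleton (hA : IsConn G A) {u : V} (hu : u ∈ A)
    (h : ∀ y ∈ A, ¬ G.Adj u y) : A = {u} := by
  refine Set.Subset.antisymm (hA.2 {u} ⟨u, hu, rfl⟩ ?_) (by simpa using hu)
  rintro x - rfl y hy hxy
  exact absurd hxy (h y hy)

end Basic

section Transport

variable {α β γ : Type*} {H : SimpleGraph α} {G : SimpleGraph β} {K : SimpleGraph γ}

lemma IsInducedMinor.comp_iso (h : IsInducedMinor H G) (e : K ≃g H) : IsInducedMinor K G := by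
  obtain ⟨μ, h1, h2, h3, h4⟩ := h
  refine ⟨μ ∘ e, fun a => h1 _, fun a b hab => h2 _ _ (e.injective.ne hab), fun a => h3 _, ?_⟩
  intro a b hab
  exact (h4 _ _ (e.injective.ne hab)).trans e.map_adj_iff

lemma IsInducedMinor.map_iso (h : IsInducedMinor H G) (e : G ≃g K) : IsInducedMinor H K := by
  obtain ⟨μ, h1, h2, h3, h4⟩ := h
  refine ⟨fun a => Set.image e (μ a), fun a => (h1 a).image _,
    fun a b hab => (Set.disjoint_image_iff e.injective).2 (h2 a b hab), fun a => ?_, ?_⟩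
  · refine (Iso.connected_iff (G := G.induce (μ a)) ⟨e.toEquiv.image _, ?_⟩).1 (h3 a)
    intro x y
    exact e.map_adj_iff
  · intro a b hab
    rw [← h4 a b hab]
    simp [e.map_adj_iff]

lemma IsInducedMinor.of_embedding (e : H ↪g G) : IsInducedMinor H G := by
  refine ⟨fun a => {e a}, fun a => Set.singleton_nonempty _, ?_, ?_, ?_⟩
  · intro a b hab
    simpa using e.injective.ne hab
  · intro a
    have : Subsingleton ({e a} : Set β) := Set.subsingleton_singleton.coe_sort
    exact ⟨Preconnected.of_subsingleton⟩
  · intro a b _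
    simp

/-- If `Excl(H)` is well-quasi-ordered, then `H` is an induced minor of some term of every
bad sequence. -/
lemma exists_inducedMinor_of_wqo (h : WqoClass (fun G => ¬ IsInducedMinor H G.2))
    (V : ℕ → Type) [∀ i, Fintype (V i)] (G : ∀ i, SimpleGraph (V i))
    (hG : ∀ i j, i < j → ¬ IsInducedMinor (G i) (G j)) : ∃ i, IsInducedMinor H (G i) := by
  classical
  by_contra! hH
  let e : ∀ i, (G i).map (Fintype.equivFin (V i)).toEmbedding ≃g G i :=
    fun i => (Iso.map (Fintype.equivFin (V i)) (G i)).symm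
  obtain ⟨i, j, hij, hm⟩ := h
    (fun i => ⟨Fintype.card (V i), (G i).map (Fintype.equivFin (V i)).toEmbedding⟩)
    (fun i hm => hH i (hm.map_iso (e i)))
  exact hG i j hij ((IsInducedMinor.map_iso hm (e j)).comp_iso (e i).symm)

end Transport

section Antiholes

/-- The cycle on `ZMod m`. -/
def cyc (m : ℕ) : SimpleGraph (ZMod m) := SimpleGraph.fromRel fun a b => b = a + 1

lemma cyc_adj {m : ℕ} {a b : ZMod m} (h : (cyc m).Adj a b) : b = a + 1 ∨ b = a - 1 := by
  rcases h with ⟨-, h | h⟩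
  · exact .inl h
  · exact .inr (by rw [h]; ring)

lemma IsInducedMinor.exists_injective_of_compl {α V : Type*} {H : SimpleGraph α}
    {G : SimpleGraph V} (h : IsInducedMinor H Gᶜ) :
    ∃ f : α → V, Function.Injective f ∧ ∀ a b, a ≠ b → ¬ H.Adj a b → G.Adj (f a) (f b) := by
  obtain ⟨μ, h1, h2, -, h4⟩ := h
  choose f hf using h1
  have hinj : Function.Injective f := by
    intro a b hab
    by_contra hne
    exact Set.disjoint_left.1 (h2 a b hne) (hf a) (hab ▸ hf b)
  refine ⟨f, hinj, fun a b hab hn => ?_⟩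
  by_contra hG
  exact hn ((h4 a b hab).1 ⟨f a, hf a, f b, hf b, (compl_adj _ _ _).2 ⟨hinj.ne hab, hG⟩⟩)

/-- A set of residues closed under adding one is everything. -/
lemma ZMod.surjective_of_add_one {n m : ℕ} [NeZero m] (f : ZMod n → ZMod m)
    (h : ∀ i, ∃ j, f j = f i + 1) : Function.Surjective f := by
  have key : ∀ k : ℕ, ∃ j, f j = f 0 + k := by
    intro k
    induction k with
    | zero => exact ⟨0, by simp⟩
    | succ k ih =>
      obtain ⟨j, hj⟩ := ih
      obtain ⟨j', hj'⟩ := h j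
      exact ⟨j', by rw [hj', hj]; push_cast; ring⟩
  intro y
  obtain ⟨j, hj⟩ := key (y - f 0).val
  exact ⟨j, by rw [hj, ZMod.natCast_zmod_val]; ring⟩

lemma ZMod.le_of_add_one {n m : ℕ} [NeZero n] [NeZero m] (f : ZMod n → ZMod m)
    (h : ∀ i, ∃ j, f j = f i + 1) : m ≤ n := by
  simpa [ZMod.card] using Fintype.card_le_of_surjective f (ZMod.surjective_of_add_one f h)

lemma ZMod.natCast_ne_zero_of_lt {n : ℕ} (k : ℕ) (hk : 0 < k) (hkn : k < n) :
    (k : ZMod n) ≠ 0 := by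
  rw [Ne, ZMod.natCast_eq_zero_iff]
  exact Nat.not_dvd_of_pos_of_lt hk hkn

lemma cyc_adj_add_one {n : ℕ} (hn : 1 < n) (i : ZMod n) : (cyc n).Adj i (i + 1) := by
  have := ZMod.natCast_ne_zero_of_lt (n := n) 1 one_pos hn
  refine (fromRel_adj _ _ _).2 ⟨?_, .inl rfl⟩
  simpa [eq_comm] using this

lemma ZMod.add_one_ne_sub_one {n : ℕ} (hn : 2 < n) (i : ZMod n) : i + 1 ≠ i - 1 := by
  intro h
  refine ZMod.natCast_ne_zero_of_lt (n := n) 2 two_pos hn ?_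
  push_cast
  linear_combination h

lemma antihole_bad {n m : ℕ} (hn : 2 < n) (hnm : n < m) :
    ¬ IsInducedMinor (cyc n)ᶜ (cyc m)ᶜ := by
  intro h
  have : NeZero n := ⟨by omega⟩
  have : NeZero m := ⟨by omega⟩
  obtain ⟨f, hf, hadj⟩ := h.exists_injective_of_compl
  have hedge : ∀ i, (cyc m).Adj (f i) (f (i + 1)) := fun i => by
    have h1 := cyc_adj_add_one (by omega) i
    exact hadj _ _ h1.ne (by simp [compl_adj, h1])
  refine absurd (ZMod.le_of_add_one f fun i => ?_) (not_le.2 hnm)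
  have h1 := cyc_adj (hedge i)
  have h2 := hedge (i - 1)
  rw [sub_add_cancel] at h2
  have h3 := cyc_adj h2.symm
  have h4 := hf.ne (ZMod.add_one_ne_sub_one hn i)
  rcases h1 with h1 | h1
  · exact ⟨_, h1⟩
  rcases h3 with h3 | h3
  · exact ⟨_, h3⟩
  · exact absurd (h1.trans h3.symm) h4

end Antiholes

section SplitGraphs

/-- The split graph with clique `inl i` and independent set `inr j`, where `inr j` is
adjacent to every `inl i` except `inl j` and `inl (j + 1)`. -/
def coSun (n : ℕ) : SimpleGraph (ZMod n ⊕ ZMod n) where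
  Adj
    | .inl i, .inl j => i ≠ j
    | .inl i, .inr j => i ≠ j ∧ i ≠ j + 1
    | .inr j, .inl i => i ≠ j ∧ i ≠ j + 1
    | .inr _, .inr _ => False
  symm := ⟨by rintro (i | i) (j | j) h <;> simp_all [eq_comm]⟩
  loopless := ⟨by rintro (i | i) <;> simp⟩

@[simp] lemma coSun_adj_inl_inl {n : ℕ} {i j : ZMod n} :
    (coSun n).Adj (.inl i) (.inl j) ↔ i ≠ j := Iff.rfl

@[simp] lemma coSun_adj_inl_inr {n : ℕ} {i j : ZMod n} :
    (coSun n).Adj (.inl i) (.inr j) ↔ i ≠ j ∧ i ≠ j + 1 := Iff.rfl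

@[simp] lemma coSun_adj_inr_inl {n : ℕ} {i j : ZMod n} :
    (coSun n).Adj (.inr j) (.inl i) ↔ i ≠ j ∧ i ≠ j + 1 := Iff.rfl

@[simp] lemma coSun_adj_inr_inr {n : ℕ} {i j : ZMod n} :
    ¬ (coSun n).Adj (.inr j) (.inr i) := id

/-- A connected set in a co-sun meets the clique or is a single independent vertex. -/
lemma IsConn.coSun_cases {n : ℕ} {A : Set (ZMod n ⊕ ZMod n)} (hA : IsConn (coSun n) A) :
    (∃ i, .inl i ∈ A) ∨ ∃ j, A = {.inr j} := by
  by_cases h : ∃ i, .inl i ∈ A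
  · exact .inl h
  · obtain ⟨x | j, hx⟩ := hA.1
    · exact absurd ⟨x, hx⟩ h
    · refine .inr ⟨j, hA.eq_singleton hx ?_⟩
      rintro (y | y) hy
      · exact absurd ⟨y, hy⟩ h
      · exact id

/-- An induced minor of a co-sun is a split graph. -/
lemma IsInducedMinor.isSplit {α : Type*} {H : SimpleGraph α} {n : ℕ}
    (h : IsInducedMinor H (coSun n)) :
    ∃ K : Set α, (∀ a ∈ K, ∀ b ∈ K, a ≠ b → H.Adj a b) ∧
      ∀ a ∉ K, ∀ b ∉ K, ¬ H.Adj a b := by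
  obtain ⟨μ, -, h2, h3, h4⟩ := h
  refine ⟨{a | ∃ i, .inl i ∈ μ a}, ?_, ?_⟩
  · rintro a ⟨i, hi⟩ b ⟨j, hj⟩ hab
    refine (h4 a b hab).1 ⟨_, hi, _, hj, ?_⟩
    simp only [coSun_adj_inl_inl]
    rintro rfl
    exact Set.disjoint_left.1 (h2 a b hab) hi hj
  · intro a ha b hb hab
    obtain ⟨i, hi⟩ := (isConn_of_connected (h3 a)).coSun_cases.resolve_left ha
    obtain ⟨j, hj⟩ := (isConn_of_connected (h3 b)).coSun_cases.resolve_left hb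
    obtain ⟨x, hx, y, hy, hxy⟩ := (h4 a b hab.ne).2 hab
    rw [hi] at hx
    rw [hj] at hy
    obtain rfl := hx
    obtain rfl := hy
    exact coSun_adj_inr_inr hxy

lemma coSun_bad {n m : ℕ} (hn : 4 < n) (hnm : n < m) :
    ¬ IsInducedMinor (coSun n) (coSun m) := by
  rintro ⟨μ, -, h2, h3, h4⟩
  have : NeZero n := ⟨by omega⟩
  have : NeZero m := ⟨by omega⟩
  have hc := fun a => (isConn_of_connected (h3 a)).coSun_cases
  have one : (1 : ZMod n) ≠ 0 := by
    simpa using ZMod.natCast_ne_zero_of_lt (n := n) 1 one_pos (by omega)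
  have two : (2 : ZMod n) ≠ 0 := by
    simpa using ZMod.natCast_ne_zero_of_lt (n := n) 2 two_pos (by omega)
  have three : (3 : ZMod n) ≠ 0 := by
    simpa using ZMod.natCast_ne_zero_of_lt (n := n) 3 three_pos (by omega)
  have disj : ∀ {a b x}, x ∈ μ a → x ∈ μ b → a = b := fun {a b x} ha hb => by
    by_contra hne
    exact Set.disjoint_left.1 (h2 a b hne) ha hb
  -- the independent vertices are mapped to single independent vertices
  have hS : ∀ j, ∃ k, μ (.inr j) = {.inr k} := by
    intro j
    refine (hc (.inr j)).resolve_left ?_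
    rintro ⟨x, hx⟩
    have near : ∀ i, i ≠ j → ∃ k, .inr k ∈ μ (.inr i) ∧ (x = k ∨ x = k + 1) := by
      intro i hij
      have hna : ¬ ∃ u ∈ μ (.inr i), ∃ v ∈ μ (.inr j), (coSun m).Adj u v := fun h =>
        coSun_adj_inr_inr ((h4 (.inr i) (.inr j) (by simpa using hij)).1 h)
      rcases hc (.inr i) with ⟨y, hy⟩ | ⟨k, hk⟩
      · refine absurd ⟨_, hy, _, hx, ?_⟩ hna
        simp only [coSun_adj_inl_inl]
        rintro rfl
        exact hij (Sum.inr_injective (disj hy hx))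
      · have hkm : Sum.inr k ∈ μ (.inr i) := by rw [hk]; rfl
        refine ⟨k, hkm, ?_⟩
        by_contra! hne
        exact hna ⟨_, hkm, _, hx, by simpa using hne⟩
    obtain ⟨k₁, hk₁, h₁⟩ := near (j + 1) (by simpa using one)
    obtain ⟨k₂, hk₂, h₂⟩ := near (j + 2) (by simpa using two)
    obtain ⟨k₃, hk₃, h₃⟩ := near (j + 3) (by simpa using three)
    have d₁₂ : k₁ ≠ k₂ := by
      rintro rfl
      have := Sum.inr_injective (disj hk₁ hk₂)
      exact one (by linear_combination -this)
    have d₁₃ : k₁ ≠ k₃ := by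
      rintro rfl
      have := Sum.inr_injective (disj hk₁ hk₃)
      exact two (by linear_combination -this)
    have d₂₃ : k₂ ≠ k₃ := by
      rintro rfl
      have := Sum.inr_injective (disj hk₂ hk₃)
      exact one (by linear_combination -this)
    grind
  choose f hf using hS
  have hfm : ∀ j, Sum.inr (f j) ∈ μ (.inr j) := fun j => by rw [hf]; rfl
  have hK : ∀ i, ∃ x, Sum.inl x ∈ μ (.inl i) := by
    intro i
    refine (hc (.inl i)).resolve_right ?_
    rintro ⟨k, hk⟩
    have hadj : (coSun n).Adj (.inl i) (.inr (i + 1)) := by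
      refine coSun_adj_inl_inr.2 ⟨by simpa using one, fun h => two ?_⟩
      linear_combination -h
    obtain ⟨u, hu, v, hv, huv⟩ := (h4 _ _ hadj.ne).2 hadj
    rw [hk] at hu
    rw [hf] at hv
    obtain rfl := hu
    obtain rfl := hv
    exact coSun_adj_inr_inr huv
  choose x hx using hK
  have near : ∀ i j, i = j ∨ i = j + 1 → x i = f j ∨ x i = f j + 1 := by
    intro i j hij
    by_contra! hne
    have := (h4 (.inl i) (.inr j) (by simp)).1 ⟨_, hx i, _, hfm j, coSun_adj_inl_inr.2 hne⟩
    exact hij.elim this.1 this.2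
  have hfinj : Function.Injective f := fun i j h =>
    Sum.inr_injective (disj (hfm i) (h ▸ hfm j))
  have hxinj : Function.Injective x := fun i j h =>
    Sum.inl_injective (disj (hx i) (h ▸ hx j))
  refine absurd (ZMod.le_of_add_one f fun i => ?_) (not_le.2 hnm)
  have n1 := near i i (.inl rfl)
  have n2 := near (i + 1) i (.inr rfl)
  have n3 := near i (i - 1) (.inr (by ring))
  have n4 := near (i + 1) (i + 1) (.inl rfl)
  have d1 : x i ≠ x (i + 1) := hxinj.ne (by simpa using one)
  have d2 : f i ≠ f (i - 1) := hfinj.ne fun h => one (by linear_combination h)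
  have d3 : f i ≠ f (i + 1) := hfinj.ne (by simpa using one)
  by_cases h1 : x i = f i + 1
  · exact ⟨i - 1, by grind⟩
  · exact ⟨i + 1, by grind⟩

end SplitGraphs

section Chains

/-- `G` is a chain of independent sets, the levels `0, …, m`, consecutive ones being completely
joined; a level has at most two vertices, or at most three if it is the first or last one. -/
structure IsChain {V : Type*} (G : SimpleGraph V) (lev col : V → ℕ) (m : ℕ) : Prop where
  adj_iff : ∀ u v, G.Adj u v ↔ lev u + 1 = lev v ∨ lev v + 1 = lev u
  ext : ∀ u v, lev u = lev v → col u = col v → u = v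
  lev_le : ∀ u, lev u ≤ m
  col_lt : ∀ u, col u < 3
  col_lt_of_inner : ∀ u, 0 < lev u → lev u < m → col u < 2
  two_lt : 2 < m

variable {V : Type*} {G : SimpleGraph V} {lev col : V → ℕ} {m : ℕ} {A B : Set V}

lemma IsChain.eq_of_three (hG : IsChain G lev col m) {u v w : V} (huv : lev u = lev v)
    (huw : lev u = lev w) (h0 : 0 < lev u) (hm : lev u < m) : u = v ∨ u = w ∨ v = w := by
  have h1 := hG.col_lt_of_inner u h0 hm
  have h2 := hG.col_lt_of_inner v (by omega) (by omega)
  have h3 := hG.col_lt_of_inner w (by omega) (by omega)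
  have e1 := hG.ext u v huv
  have e2 := hG.ext u w huw
  have e3 := hG.ext v w (by omega)
  rcases (by omega : col u = col v ∨ col u = col w ∨ col v = col w) with h | h | h
  · exact .inl (e1 h)
  · exact .inr (.inl (e2 h))
  · exact .inr (.inr (e3 h))

/-- A connected set missing level `p` lies on one side of it. -/
lemma IsChain.lt_or_gt (hG : IsChain G lev col m) (hA : IsConn G A) {p : ℕ}
    (hp : ∀ u ∈ A, lev u ≠ p) : (∀ u ∈ A, lev u < p) ∨ ∀ u ∈ A, p < lev u := by
  obtain ⟨u, hu⟩ := hA.1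
  rcases lt_or_gt_of_ne (hp u hu) with h | h
  · refine .inl (hA.2 {v | lev v < p} ⟨u, hu, h⟩ fun x _ hx y hy hxy => ?_)
    have := (hG.adj_iff x y).1 hxy
    have := hp y hy
    simp only [Set.mem_ofPred_eq] at *
    omega
  · refine .inr (hA.2 {v | p < lev v} ⟨u, hu, h⟩ fun x _ hx y hy hxy => ?_)
    have := (hG.adj_iff x y).1 hxy
    have := hp y hy
    simp only [Set.mem_ofPred_eq] at *
    omega

/-- A connected set meets every level between two of its levels. -/
lemma IsChain.exists_between (hG : IsChain G lev col m) (hA : IsConn G A) {p : ℕ} {u v : V}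
    (hu : u ∈ A) (hv : v ∈ A) (hup : lev u ≤ p) (hpv : p ≤ lev v) : ∃ w ∈ A, lev w = p := by
  by_contra! h
  rcases hG.lt_or_gt hA h with h | h
  · have := h v hv; omega
  · have := h u hu; omega

/-- Of two connected sets without an edge between them that meet a common level, the first one
is a singleton. -/
lemma IsChain.eq_singleton (hG : IsChain G lev col m) (hA : IsConn G A)
    (hAB : ¬ Touch G A B) {u v : V} (hu : u ∈ A) (hv : v ∈ B) (huv : lev u = lev v) :
    A = {u} := by
  refine hA.eq_singleton hu fun y hy huy => hAB ⟨y, hy, v, hv, ?_⟩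
  rw [hG.adj_iff] at huy ⊢
  omega

/-- Two connected sets without an edge between them that meet no common level are separated
by a level. -/
lemma IsChain.separated (hG : IsChain G lev col m) (hA : IsConn G A) (hB : IsConn G B)
    (hAB : ¬ Touch G A B) (hlev : ∀ u ∈ A, ∀ v ∈ B, lev u ≠ lev v) :
    ∃ p, ((∀ u ∈ A, lev u < p) ∧ ∀ v ∈ B, p < lev v) ∨
      ((∀ v ∈ B, lev v < p) ∧ ∀ u ∈ A, p < lev u) := by
  have key : ∀ {A B : Set V}, IsConn G A → IsConn G B → ¬ Touch G A B →
      (∀ u ∈ A, ∀ v ∈ B, lev u ≠ lev v) → (∃ u ∈ A, ∀ v ∈ B, lev u < lev v) →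
      ∃ p, (∀ u ∈ A, lev u < p) ∧ ∀ v ∈ B, p < lev v := by
    rintro A B hA hB hAB hlev ⟨u, hu, huB⟩
    obtain ⟨v, hv, hmin⟩ := (wellFounded_lt (α := ℕ)).has_min (Set.image lev B) (hB.1.image _)
    obtain ⟨v, hvB, rfl⟩ := hv
    have hltv : ∀ x ∈ A, lev x < lev v :=
      (hG.lt_or_gt hA fun x hx => hlev x hx v hvB).resolve_right fun h => by
        have := h u hu
        have := huB v hvB
        omega
    have huv := huB v hvB
    refine ⟨lev v - 1, fun x hx => ?_, fun y hy => ?_⟩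
    · have h1 := hltv x hx
      have h2 : lev x + 1 ≠ lev v := fun h =>
        hAB ⟨x, hx, v, hvB, (hG.adj_iff x v).2 (.inl h)⟩
      omega
    · have := hmin (lev y) ⟨y, hy, rfl⟩
      omega
  obtain ⟨u, hu⟩ := hA.1
  rcases hG.lt_or_gt hB fun v hv => (hlev u hu v hv).symm with h | h
  · have hBA : ¬ Touch G B A := fun h => hAB h.symm
    obtain ⟨v, hv⟩ := hB.1
    have h' : ∀ x ∈ A, lev v < lev x :=
      (hG.lt_or_gt hA fun x hx => hlev x hx v hv).resolve_left fun h' => by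
        have := h' u hu
        have := h v hv
        omega
    obtain ⟨p, hp⟩ := key hB hA hBA (fun x hx y hy => (hlev y hy x hx).symm) ⟨v, hv, h'⟩
    exact ⟨p, .inr hp⟩
  · obtain ⟨p, hp⟩ := key hA hB hAB hlev ⟨u, hu, h⟩
    exact ⟨p, .inl hp⟩

/-- A connected set with an edge to each of two sets separated by level `p` meets `p`. -/
lemma IsChain.exists_mem_gap (hG : IsChain G lev col m) {X : Set V} (hX : IsConn G X) {p : ℕ}
    (hA : ∀ u ∈ A, lev u < p) (hB : ∀ v ∈ B, p < lev v) (hXA : Touch G X A)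
    (hXB : Touch G X B) : ∃ w ∈ X, lev w = p := by
  obtain ⟨x, hx, a, ha, hxa⟩ := hXA
  obtain ⟨y, hy, b, hb, hyb⟩ := hXB
  rw [hG.adj_iff] at hxa hyb
  have := hA a ha
  have := hB b hb
  exact hG.exists_between hX hx hy (by omega) (by omega)

/-- Five connected sets, pairwise disjoint and joined by edges, cannot all meet the union of
an end level and the level next to it. -/
lemma IsChain.not_five_near_end (hG : IsChain G lev col m) {T : Fin 5 → Set V}
    (hT : ∀ i, IsConn G (T i)) (hd : ∀ i j, i ≠ j → Disjoint (T i) (T j))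
    (ht : ∀ i j, i < j → Touch G (T i) (T j)) {e q : ℕ}
    (he : (e = 0 ∧ q = 1) ∨ (e = m ∧ q + 1 = m))
    (hmeet : ∀ i, ∃ u ∈ T i, lev u = e ∨ lev u = q) : False := by
  have hm := hG.two_lt
  have hcode : ∀ i, ∃ k : Fin 3, (∃ u ∈ T i, lev u = q ∧ col u = k.1 ∧ k.1 < 2) ∨
      (k = 2 ∧ ∀ u ∈ T i, lev u = e) := by
    intro i
    by_cases h : ∃ u ∈ T i, lev u = q
    · obtain ⟨u, hu, hq⟩ := h
      have := hG.col_lt_of_inner u (by omega) (by omega)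
      exact ⟨⟨col u, by omega⟩, .inl ⟨u, hu, hq, rfl, this⟩⟩
    · push Not at h
      obtain ⟨u, hu, hue⟩ := hmeet i
      have hue := hue.resolve_right (h u hu)
      have hs : T i = {u} := (hT i).eq_singleton hu fun y hy huy => by
        rw [hG.adj_iff] at huy
        have := h y hy
        have := hG.lev_le y
        omega
      exact ⟨2, .inr ⟨rfl, by simp [hs, hue]⟩⟩
  choose k hk using hcode
  obtain ⟨i, j, hij, hkij⟩ := Fintype.exists_ne_map_eq_of_card_lt k (by simp)
  wlog hlt : i < j generalizing i j
  · exact this j i hij.symm hkij.symm (lt_of_le_of_ne (not_lt.1 hlt) hij.symm)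
  have hi := hk i
  have hj := hk j
  rw [← hkij] at hj
  rcases hi with ⟨u, hu, hu1, hu2, hu3⟩ | ⟨hk2, hi⟩
  · rcases hj with ⟨v, hv, hv1, hv2, -⟩ | ⟨hk2, -⟩
    · obtain rfl := hG.ext u v (by omega) (by omega)
      exact Set.disjoint_left.1 (hd i j hij) hu hv
    · rw [hk2] at hu3
      simp at hu3
  · rcases hj with ⟨v, hv, hv1, hv2, hv3⟩ | ⟨-, hj⟩
    · rw [hk2] at hv3
      simp at hv3
    · obtain ⟨x, hx, y, hy, hxy⟩ := ht i j hlt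
      rw [hG.adj_iff] at hxy
      have := hi x hx
      have := hj y hy
      omega

lemma IsChain.not_K5 (hG : IsChain G lev col m) {T : Fin 5 → Set V}
    (hT : ∀ i, IsConn G (T i)) (hd : ∀ i j, i ≠ j → Disjoint (T i) (T j))
    (ht : ∀ i j, i < j → Touch G (T i) (T j)) : False := by
  have hm := hG.two_lt
  -- the smallest `r` such that some branch set lies in the levels up to `r`
  have hex : ∃ r, ∃ i, ∀ u ∈ T i, lev u ≤ r := ⟨m, 0, fun u _ => hG.lev_le u⟩
  classical
  obtain ⟨i₀, hi₀⟩ := Nat.find_spec hex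
  set r := Nat.find hex with hr
  have hrm : r ≤ m := Nat.find_min' hex ⟨0, fun u _ => hG.lev_le u⟩
  have hup : ∀ j, ∃ u ∈ T j, r ≤ lev u := by
    intro j
    by_contra! h
    obtain ⟨u, hu⟩ := (hT j).1
    have h1 : r - 1 < r := by have := h u hu; omega
    exact Nat.find_min hex h1 ⟨j, fun v hv => by have := h v hv; omega⟩
  have hmeet : ∀ j, ∃ u ∈ T j, lev u = r ∨ lev u = r + 1 := by
    intro j
    obtain ⟨v, hv, hrv⟩ := hup j
    by_cases hj : j = i₀
    · subst hj
      exact ⟨v, hv, .inl (le_antisymm (hi₀ v hv) hrv)⟩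
    · have htj : Touch G (T j) (T i₀) := by
        rcases lt_or_gt_of_ne hj with h | h
        · exact ht _ _ h
        · exact (ht _ _ h).symm
      obtain ⟨x, hx, y, hy, hxy⟩ := htj
      rw [hG.adj_iff] at hxy
      have := hi₀ y hy
      rcases le_or_gt (lev x) r with h | h
      · obtain ⟨w, hw, hwr⟩ := hG.exists_between (hT j) hx hv h hrv
        exact ⟨w, hw, .inl hwr⟩
      · exact ⟨x, hx, .inr (by omega)⟩
  by_cases h0 : r = 0
  · exact hG.not_five_near_end hT hd ht (e := 0) (q := 1) (.inl ⟨rfl, rfl⟩)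
      (by simpa [h0] using hmeet)
  by_cases h1 : r + 1 < m
  · choose u hu hur using hmeet
    have hc : ∀ j, 2 * (lev (u j) - r) + col (u j) < 4 := fun j => by
      have := hur j
      have := hG.col_lt_of_inner (u j) (by omega) (by omega)
      omega
    obtain ⟨i, j, hij, hkij⟩ := Fintype.exists_ne_map_eq_of_card_lt
      (fun j => (⟨_, hc j⟩ : Fin 4)) (by simp)
    simp only [Fin.mk.injEq] at hkij
    have a1 := hur i
    have a2 := hur j
    have a3 := hG.col_lt_of_inner (u i) (by omega) (by omega)
    have a4 := hG.col_lt_of_inner (u j) (by omega) (by omega)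
    have heq := hG.ext (u i) (u j) (by omega) (by omega)
    exact Set.disjoint_left.1 (hd i j hij) (hu i) (heq ▸ hu j)
  · refine hG.not_five_near_end hT hd ht (e := m) (q := m - 1) (.inr ⟨rfl, by omega⟩) ?_
    intro j
    obtain ⟨u, hu, hur⟩ := hmeet j
    have := hG.lev_le u
    exact ⟨u, hu, by omega⟩

/-- A chain has no `K₅` minus an edge as a minor. -/
lemma IsChain.not_K5_minus (hG : IsChain G lev col m) {T : Fin 5 → Set V}
    (hT : ∀ i, IsConn G (T i)) (hd : ∀ i j, i ≠ j → Disjoint (T i) (T j))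
    (ht : ∀ i j, i < j → i ≠ 3 → Touch G (T i) (T j)) : False := by
  have hm := hG.two_lt
  have hne : ∀ {i j u v}, u ∈ T i → v ∈ T j → i ≠ j → u ≠ v := by
    rintro i j u v hu hv hij rfl
    exact Set.disjoint_left.1 (hd i j hij) hu hv
  have t01 := ht 0 1 (by decide) (by decide)
  have t02 := ht 0 2 (by decide) (by decide)
  have t12 := ht 1 2 (by decide) (by decide)
  have t3 : ∀ i : Fin 5, i < 3 → Touch G (T i) (T 3) := fun i hi => ht i 3 hi hi.ne
  have t4 : ∀ i : Fin 5, i < 3 → Touch G (T i) (T 4) := fun i hi =>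
    ht i 4 (hi.trans (by decide)) hi.ne
  -- the three vertices of full degree cannot all meet one level of size two
  have three : ∀ p, 0 < p → p < m → ¬ ∀ i : Fin 5, i < 3 → ∃ u ∈ T i, lev u = p := by
    intro p hp hpm h
    obtain ⟨a, ha, hap⟩ := h 0 (by decide)
    obtain ⟨b, hb, hbp⟩ := h 1 (by decide)
    obtain ⟨c, hc, hcp⟩ := h 2 (by decide)
    rcases hG.eq_of_three (u := a) (v := b) (w := c) (by omega) (by omega) (by omega)
      (by omega) with h | h | h
    · exact hne ha hb (by decide) h
    · exact hne ha hc (by decide) h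
    · exact hne hb hc (by decide) h
  by_cases h34 : Touch G (T 3) (T 4)
  · refine hG.not_K5 hT hd fun i j hij => ?_
    by_cases hi : i = 3
    · obtain rfl : j = 4 := by omega
      rwa [hi]
    · exact ht i j hij hi
  by_cases hlev : ∃ u ∈ T 3, ∃ v ∈ T 4, lev u = lev v
  · obtain ⟨d, hd3, e, he4, hde⟩ := hlev
    have h3 := hG.eq_singleton (hT 3) h34 hd3 he4 hde
    have near : ∀ i : Fin 5, i < 3 → ∃ u ∈ T i, lev u + 1 = lev d ∨ lev d + 1 = lev u := by
      intro i hi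
      obtain ⟨x, hx, y, hy, hxy⟩ := t3 i hi
      rw [h3] at hy
      obtain rfl := hy
      exact ⟨x, hx, (hG.adj_iff _ _).1 hxy⟩
    have hdm := hG.lev_le d
    by_cases h0 : lev d = 0
    · refine three 1 one_pos (by omega) fun i hi => ?_
      obtain ⟨u, hu, h⟩ := near i hi
      exact ⟨u, hu, by omega⟩
    by_cases h1 : lev d = m
    · refine three (m - 1) (by omega) (by omega) fun i hi => ?_
      obtain ⟨u, hu, h⟩ := near i hi
      have := hG.lev_le u
      exact ⟨u, hu, by omega⟩
    have miss : ∀ i : Fin 5, i < 3 → ∀ u ∈ T i, lev u ≠ lev d := by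
      intro i hi u hu hud
      have hi4 : i ≠ 4 := (hi.trans (by decide)).ne
      rcases hG.eq_of_three (u := u) (v := d) (w := e) (by omega) (by omega) (by omega)
        (by omega) with h | h | h
      · exact hne hu hd3 hi.ne h
      · exact hne hu he4 hi4 h
      · exact hne hd3 he4 (by decide) h
    have side := fun (i : Fin 5) (hi : i < 3) => hG.lt_or_gt (hT i) (miss i hi)
    have same : ∀ i j : Fin 5, Touch G (T i) (T j) → (∀ u ∈ T i, lev u < lev d) →
        (∀ u ∈ T j, lev d < lev u) → False := by
      rintro i j ⟨x, hx, y, hy, hxy⟩ hi hj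
      rw [hG.adj_iff] at hxy
      have := hi x hx
      have := hj y hy
      omega
    obtain ⟨x, hx, y, hy, hxy⟩ := t01
    have hxy' := (hG.adj_iff _ _).1 hxy
    have t01 : Touch G (T 0) (T 1) := ⟨x, hx, y, hy, hxy⟩
    rcases side 0 (by decide) with s0 | s0
    · have s1 := (side 1 (by decide)).resolve_right (same 0 1 t01 s0)
      have s2 := (side 2 (by decide)).resolve_right (same 0 2 t02 s0)
      have := s0 x hx
      have := s1 y hy
      refine three (lev d - 1) (by omega) (by omega) fun i hi => ?_
      obtain ⟨u, hu, h⟩ := near i hi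
      have hs : ∀ u ∈ T i, lev u < lev d := by
        obtain rfl | rfl | rfl : i = 0 ∨ i = 1 ∨ i = 2 := by omega
        exacts [s0, s1, s2]
      have := hs u hu
      exact ⟨u, hu, by omega⟩
    · have s1 := (side 1 (by decide)).resolve_left fun h => same 1 0 t01.symm h s0
      have s2 := (side 2 (by decide)).resolve_left fun h => same 2 0 t02.symm h s0
      have := s0 x hx
      have := s1 y hy
      have := hG.lev_le x
      have := hG.lev_le y
      refine three (lev d + 1) (by omega) (by omega) fun i hi => ?_
      obtain ⟨u, hu, h⟩ := near i hi
      have hs : ∀ u ∈ T i, lev d < lev u := by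
        obtain rfl | rfl | rfl : i = 0 ∨ i = 1 ∨ i = 2 := by omega
        exacts [s0, s1, s2]
      have := hs u hu
      exact ⟨u, hu, by omega⟩
  · push Not at hlev
    obtain ⟨a, ha⟩ := (hT 3).1
    obtain ⟨b, hb⟩ := (hT 4).1
    have := hG.lev_le a
    have := hG.lev_le b
    obtain ⟨p, ⟨hp1, hp2⟩ | ⟨hp1, hp2⟩⟩ := hG.separated (hT 3) (hT 4) h34 hlev
    · have := hp1 a ha
      have := hp2 b hb
      exact three p (by omega) (by omega) fun i hi =>
        hG.exists_mem_gap (hT i) hp1 hp2 (t3 i hi) (t4 i hi)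
    · have := hp1 b hb
      have := hp2 a ha
      exact three p (by omega) (by omega) fun i hi =>
        hG.exists_mem_gap (hT i) hp1 hp2 (t4 i hi) (t3 i hi)

/-- In a model of a chain in a chain, two branch sets from one level of the model share a
level. -/
lemma IsChain.exists_common_level (hG : IsChain G lev col m) {X Y X₁ Y₁ X₂ Y₂ X₃ : Set V}
    (cX : IsConn G X) (cY : IsConn G Y) (cX₁ : IsConn G X₁) (cY₁ : IsConn G Y₁)
    (cX₂ : IsConn G X₂) (cY₂ : IsConn G Y₂) (cX₃ : IsConn G X₃)
    (nXY : ¬ Touch G X Y) (nXY₁ : ¬ Touch G X₁ Y₁)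
    (tX₁X : Touch G X₁ X) (tX₁Y : Touch G X₁ Y) (tY₁X : Touch G Y₁ X) (tY₁Y : Touch G Y₁ Y)
    (tX₂ : Touch G X₂ X₁) (tY₂ : Touch G Y₂ X₁)
    (nX₂X : ¬ Touch G X₂ X) (nX₂Y : ¬ Touch G X₂ Y) (nY₂X : ¬ Touch G Y₂ X)
    (nY₂Y : ¬ Touch G Y₂ Y) (tX₃ : Touch G X₃ X₂) (tY₃ : Touch G X₃ Y₂)
    (d₁ : Disjoint X₁ Y₁) (d₂ : Disjoint X₂ Y₂) (dX₂X : Disjoint X₂ X) (dX₂Y : Disjoint X₂ Y)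
    (dY₂X : Disjoint Y₂ X) (dY₂Y : Disjoint Y₂ Y) (d₃X : Disjoint X₃ X₁)
    (d₃Y : Disjoint X₃ Y₁) : ∃ u ∈ X, ∃ v ∈ Y, lev u = lev v := by
  by_contra! hlev
  obtain ⟨p, hp⟩ := hG.separated cX cY nXY hlev
  wlog hp' : (∀ u ∈ X, lev u < p) ∧ ∀ v ∈ Y, p < lev v generalizing X Y
  · exact this cY cX (fun h => nXY h.symm) tX₁Y tX₁X tY₁Y tY₁X nX₂Y nX₂X nY₂Y nY₂X dX₂Y dX₂X
      dY₂Y dY₂X (fun u hu v hv => (hlev v hv u hu).symm) hp.symm (hp.resolve_left hp')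
  clear hp
  obtain ⟨hX, hY⟩ := hp'
  have ne : ∀ {A B : Set V} {u v : V}, Disjoint A B → u ∈ A → v ∈ B → u ≠ v := by
    rintro A B u v h hu hv rfl
    exact Set.disjoint_left.1 h hu hv
  obtain ⟨x₁, hx₁, hx₁p⟩ := hG.exists_mem_gap cX₁ hX hY tX₁X tX₁Y
  obtain ⟨y₁, hy₁, hy₁p⟩ := hG.exists_mem_gap cY₁ hX hY tY₁X tY₁Y
  have eX₁ := hG.eq_singleton cX₁ nXY₁ hx₁ hy₁ (by omega)
  -- `X` and `Y` meet the levels next to `p`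
  have adjX₁ : ∀ {A : Set V}, Touch G X₁ A → ∃ a ∈ A, lev a + 1 = p ∨ p + 1 = lev a := by
    rintro A ⟨x, hx, a, ha, hxa⟩
    rw [eX₁] at hx
    obtain rfl := hx
    rw [hG.adj_iff] at hxa
    exact ⟨a, ha, by omega⟩
  obtain ⟨x, hx, hxp⟩ := adjX₁ tX₁X
  obtain ⟨y, hy, hyp⟩ := adjX₁ tX₁Y
  have hxlt := hX x hx
  have hylt := hY y hy
  have hxm := hG.lev_le x
  have hym := hG.lev_le y
  have single : ∀ {A : Set V}, IsConn G A → Touch G A X₁ → ¬ Touch G A X → ¬ Touch G A Y →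
      ∃ a, A = {a} ∧ (lev a + 1 = p ∨ p + 1 = lev a) := by
    intro A cA tA nX nY
    obtain ⟨a, ha, hap⟩ := adjX₁ tA.symm
    refine ⟨a, ?_, hap⟩
    rcases hap with hap | hap
    · exact hG.eq_singleton cA nX ha hx (by omega)
    · exact hG.eq_singleton cA nY ha hy (by omega)
  obtain ⟨x₂, eX₂, hx₂⟩ := single cX₂ tX₂ nX₂X nX₂Y
  obtain ⟨y₂, eY₂, hy₂⟩ := single cY₂ tY₂ nY₂X nY₂Y
  subst eX₂ eY₂
  obtain ⟨a, ha, b, hb, hab⟩ := tX₃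
  obtain ⟨a', ha', b', hb', hab'⟩ := tY₃
  obtain rfl := hb
  obtain rfl := hb'
  rw [hG.adj_iff] at hab hab'
  have hxx := ne dX₂X rfl hx
  have hxy := ne dX₂Y rfl hy
  have hyx := ne dY₂X rfl hx
  have hyy := ne dY₂Y rfl hy
  have h22 := ne d₂ rfl rfl
  have miss : ∀ u ∈ X₃, lev u ≠ p := by
    intro u hu hup
    rcases hG.eq_of_three (u := u) (v := x₁) (w := y₁) (by omega) (by omega) (by omega)
      (by omega) with h | h | h
    · exact ne d₃X hu hx₁ h
    · exact ne d₃Y hu hy₁ h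
    · exact ne d₁ hx₁ hy₁ h
  have ham := hG.lev_le a
  have ham' := hG.lev_le a'
  rcases hG.lt_or_gt cX₃ miss with h | h
  · have h1 := h a ha
    have h2 := h a' ha'
    rcases hG.eq_of_three (u := b) (v := b') (w := x) (by omega) (by omega) (by omega)
      (by omega) with h | h | h
    · exact h22 h
    · exact hxx h
    · exact hyx h
  · have h1 := h a ha
    have h2 := h a' ha'
    rcases hG.eq_of_three (u := b) (v := b') (w := y) (by omega) (by omega) (by omega)
      (by omega) with h | h | h
    · exact h22 h
    · exact hxy h
    · exact hyy h


/-- The vertices of the chain with levels `0, …, m` of sizes `3, 2, …, 2, 3`. -/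
abbrev ChainVertex (m : ℕ) : Type :=
  {p : Fin (m + 1) × Fin 3 // p.2 = 2 → p.1.val = 0 ∨ p.1.val = m}

/-- The chain with levels `0, …, m` of sizes `3, 2, …, 2, 3`. -/
def chain (m : ℕ) : SimpleGraph (ChainVertex m) where
  Adj u v := u.1.1.val + 1 = v.1.1.val ∨ v.1.1.val + 1 = u.1.1.val
  symm := ⟨fun _ _ h => h.symm⟩
  loopless := ⟨fun u h => by omega⟩

lemma isChain_chain {m : ℕ} (hm : 2 < m) :
    IsChain (chain m) (fun u => u.1.1.val) (fun u => u.1.2.val) m where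
  adj_iff _ _ := Iff.rfl
  ext u v h1 h2 := Subtype.ext (Prod.ext (Fin.ext h1) (Fin.ext h2))
  lev_le u := Nat.lt_succ_iff.1 u.1.1.2
  col_lt u := u.1.2.2
  col_lt_of_inner u h1 h2 := by
    have h3 := u.1.2.2
    have h4 : u.1.2.val ≠ 2 := fun h => by
      have := u.2 (Fin.ext h)
      omega
    omega
  two_lt := hm

lemma chain_bad {n m : ℕ} (hn : 5 < n) (hnm : n < m) :
    ¬ IsInducedMinor (chain n) (chain m) := by
  rintro ⟨μ, -, h2, h3, h4⟩
  have hG := isChain_chain (m := m) (by omega)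
  have hc := fun a => isConn_of_connected (h3 a)
  have touch : ∀ a b, a.1.1.val + 1 = b.1.1.val ∨ b.1.1.val + 1 = a.1.1.val →
      Touch (chain m) (μ a) (μ b) := fun a b hab =>
    (h4 a b (by rintro rfl; omega)).2 hab
  have ntouch : ∀ a b, a ≠ b → ¬ (a.1.1.val + 1 = b.1.1.val ∨ b.1.1.val + 1 = a.1.1.val) →
      ¬ Touch (chain m) (μ a) (μ b) := fun a b hab h h' => h ((h4 a b hab).1 h')
  let mk : ∀ (i : ℕ) (j : Fin 3), i ≤ n → (j = 2 → i = 0 ∨ i = n) → ChainVertex n :=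
    fun i j hi hj => ⟨(⟨i, by omega⟩, j), hj⟩
  have ne_of_col : ∀ {i j k hi hj hk}, j ≠ k → mk i j hi hj ≠ mk i k hi hk := by
    intro i j k hi hj hk hjk h
    exact hjk (congrArg (fun u : ChainVertex n => u.1.2) h)
  have ne_of_lev : ∀ a b : ChainVertex n, a.1.1.val ≠ b.1.1.val → a ≠ b := by
    rintro a b h rfl
    exact h rfl
  have common : ∀ a b : ChainVertex n, a ≠ b → a.1.1.val = b.1.1.val →
      ∃ u ∈ μ a, ∃ v ∈ μ b, u.1.1.val = v.1.1.val := by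
    intro a b hab hlev
    have han : a.1.1.val ≤ n := Nat.lt_succ_iff.1 a.1.1.2
    obtain ⟨i₁, i₂, i₃, hi₁, hi₂, hi₃, hs⟩ : ∃ i₁ i₂ i₃, i₁ ≤ n ∧ i₂ ≤ n ∧ i₃ ≤ n ∧
        ((i₁ = a.1.1.val + 1 ∧ i₂ = a.1.1.val + 2 ∧ i₃ = a.1.1.val + 3) ∨
          (i₁ + 1 = a.1.1.val ∧ i₂ + 2 = a.1.1.val ∧ i₃ + 3 = a.1.1.val)) := by
      by_cases h : a.1.1.val + 3 ≤ n
      · exact ⟨_, _, _, by omega, by omega, h, .inl ⟨rfl, rfl, rfl⟩⟩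
      · exact ⟨a.1.1.val - 1, a.1.1.val - 2, a.1.1.val - 3, by omega, by omega, by omega,
          .inr (by omega)⟩
    have lev_mk : ∀ i j hi hj, (mk i j hi hj).1.1.val = i := fun _ _ _ _ => rfl
    refine hG.exists_common_level (hc a) (hc b)
      (hc (mk i₁ 0 hi₁ (by simp))) (hc (mk i₁ 1 hi₁ (by simp)))
      (hc (mk i₂ 0 hi₂ (by simp))) (hc (mk i₂ 1 hi₂ (by simp)))
      (hc (mk i₃ 0 hi₃ (by simp))) (ntouch _ _ hab (by omega))
      (ntouch _ _ (ne_of_col (hi := hi₁) (by decide)) (by simp only [lev_mk]; omega))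
      ?_ ?_ ?_ ?_ ?_ ?_ ?_ ?_ ?_ ?_ ?_ ?_
      (h2 _ _ (ne_of_col (hi := hi₁) (by decide)))
      (h2 _ _ (ne_of_col (hi := hi₂) (by decide))) ?_ ?_ ?_ ?_ ?_ ?_
    all_goals first
      | exact touch _ _ (by simp only [lev_mk]; omega)
      | exact ntouch _ _ (ne_of_lev _ _ (by simp only [lev_mk]; omega))
          (by simp only [lev_mk]; omega)
      | exact h2 _ _ (ne_of_lev _ _ (by simp only [lev_mk]; omega))
  have single : ∀ a, ∃ u, μ a = {u} := by
    intro a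
    have han : a.1.1.val ≤ n := Nat.lt_succ_iff.1 a.1.1.2
    obtain ⟨b, hab, hlev⟩ : ∃ b : ChainVertex n, a ≠ b ∧ a.1.1.val = b.1.1.val := by
      by_cases h : a.1.2 = 0
      · refine ⟨mk a.1.1.val 1 han (by simp), fun h' => ?_, rfl⟩
        rw [h'] at h
        exact absurd h (by simp [mk])
      · refine ⟨mk a.1.1.val 0 han (by simp), fun h' => h ?_, rfl⟩
        rw [h']
    obtain ⟨u, hu, v, hv, huv⟩ := common a b hab hlev
    exact ⟨u, hG.eq_singleton (hc a) (ntouch a b hab (by omega)) hu hv huv⟩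
  choose φ hφ using single
  have hφinj : Function.Injective φ := by
    intro a b hab
    by_contra hne
    have := h2 a b hne
    rw [hφ, hφ, hab] at this
    simp at this
  have hφlev : ∀ a b : ChainVertex n, a.1.1.val = b.1.1.val →
      (φ a).1.1.val = (φ b).1.1.val := by
    intro a b hab
    by_cases h : a = b
    · rw [h]
    · obtain ⟨u, hu, v, hv, huv⟩ := common a b h hab
      rw [hφ] at hu hv
      rwa [Set.mem_singleton_iff.1 hu, Set.mem_singleton_iff.1 hv] at huv
  have hstep : ∀ a b : ChainVertex n, a.1.1.val + 1 = b.1.1.val →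
      (φ a).1.1.val + 1 = (φ b).1.1.val ∨ (φ b).1.1.val + 1 = (φ a).1.1.val := by
    intro a b hab
    obtain ⟨u, hu, v, hv, huv⟩ := touch a b (.inl hab)
    rw [hφ] at hu hv
    obtain rfl := hu
    obtain rfl := hv
    exact huv
  let z : ChainVertex n := mk 0 0 (by omega) (by simp)
  have hdist : ∀ i hi, (φ (mk i 0 hi (by simp))).1.1.val ≤ (φ z).1.1.val + i ∧
      (φ z).1.1.val ≤ (φ (mk i 0 hi (by simp))).1.1.val + i := by
    intro i
    induction i with
    | zero => exact fun hi => ⟨le_rfl, le_rfl⟩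
    | succ i ih =>
      intro hi
      have h1 := ih (by omega)
      have h2 := hstep (mk i 0 (by omega) (by simp)) (mk (i + 1) 0 hi (by simp)) rfl
      omega
  -- an end level is mapped to an end level
  have hend : ∀ i hi (h : i = 0 ∨ i = n), ((φ (mk i 0 hi (by simp))).1.1.val = 0 ∨
      (φ (mk i 0 hi (by simp))).1.1.val = m) := by
    intro i hi h
    have hle := hG.lev_le (φ (mk i 0 hi (by simp)))
    by_contra! hcon
    rcases hG.eq_of_three (u := φ (mk i 0 hi (by simp))) (v := φ (mk i 1 hi (by simp)))
      (w := φ (mk i 2 hi fun _ => h)) (hφlev _ _ rfl) (hφlev _ _ rfl) (by omega)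
      (by omega) with h | h | h
    · exact ne_of_col (hi := hi) (by decide) (hφinj h)
    · exact ne_of_col (hi := hi) (by decide) (hφinj h)
    · exact ne_of_col (hi := hi) (by decide) (hφinj h)
  have e0 := hend 0 (by omega) (.inl rfl)
  have en := hend n le_rfl (.inr rfl)
  have hd := hdist n le_rfl
  have hne : (φ z).1.1.val ≠ (φ (mk n 0 le_rfl (by simp))).1.1.val := by
    intro heq
    let g : Fin 4 → ChainVertex n := ![z, mk 0 1 (by omega) (by simp),
      mk 0 2 (by omega) (by simp), mk n 0 le_rfl (by simp)]
    have hg : ∀ k, (φ (g k)).1.1.val = (φ z).1.1.val := by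
      intro k
      fin_cases k
      · rfl
      · exact hφlev _ _ rfl
      · exact hφlev _ _ rfl
      · exact heq.symm
    obtain ⟨k, l, hkl, h⟩ := Fintype.exists_ne_map_eq_of_card_lt
      (fun k => (φ (g k)).1.2) (by simp)
    have h' := hφinj (hG.ext _ _ ((hg k).trans (hg l).symm) (congrArg Fin.val h))
    have hginj : Function.Injective g := by
      intro k l hkl
      have h1 := congrArg (fun u : ChainVertex n => u.1.1.val) hkl
      have h2 := congrArg (fun u : ChainVertex n => u.1.2.val) hkl
      fin_cases k <;> fin_cases l <;> simp [g, z, mk] at h1 h2 ⊢ <;> omega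
    exact hkl (hginj h')
  have e0' : (φ z).1.1.val = 0 ∨ (φ z).1.1.val = m := e0
  omega

end Chains

section Classification

lemma hatK4_adj (a b : Fin 5) : hatK4.Adj a b ↔
    a ≠ b ∧ ¬ (a = 4 ∧ (b = 2 ∨ b = 3)) ∧ ¬ (b = 4 ∧ (a = 2 ∨ a = 3)) := by
  simp only [hatK4, fromRel_adj]
  revert a b
  decide

lemma gem_adj (a b : Fin 5) : gem.Adj a b ↔
    a ≠ b ∧ ¬ (a = 0 ∧ (b = 2 ∨ b = 3)) ∧ ¬ (b = 0 ∧ (a = 2 ∨ a = 3)) ∧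
      ¬ (a = 1 ∧ b = 3) ∧ ¬ (a = 3 ∧ b = 1) := by
  simp only [gem, fromRel_adj]
  revert a b
  decide

variable {α : Type*} {H : SimpleGraph α}

lemma IsInducedMinor.of_injective {β : Type*} {G : SimpleGraph β} (f : α → β)
    (hf : Function.Injective f) (h : ∀ a b, G.Adj (f a) (f b) ↔ H.Adj a b) :
    IsInducedMinor H G :=
  .of_embedding ⟨⟨f, hf⟩, h _ _⟩

lemma exists_injOn_fin {k : ℕ} (hk : 0 < k) (s : Finset α) (hs : s.card ≤ k) :
    ∃ g : α → Fin k, Set.InjOn g s := by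
  classical
  have : NeZero k := ⟨hk.ne'⟩
  refine ⟨fun a => if h : a ∈ s then (s.equivFin ⟨a, h⟩).castLE hs else 0, ?_⟩
  intro a ha b hb hab
  have ha : a ∈ s := ha
  have hb : b ∈ s := hb
  simpa [ha, hb] using hab

lemma IsInducedMinor.not_K5_minus {m : ℕ} (hm : 2 < m) (h : IsInducedMinor H (chain m))
    (g : Fin 5 → α) (hg : Function.Injective g)
    (hadj : ∀ i j, i < j → i ≠ 3 → H.Adj (g i) (g j)) : False := by
  obtain ⟨μ, -, h2, h3, h4⟩ := h
  exact (isChain_chain hm).not_K5_minus (T := fun i => μ (g i))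
    (fun i => isConn_of_connected (h3 _)) (fun i j hij => h2 _ _ (hg.ne hij))
    fun i j hij hi => (h4 _ _ (hg.ne hij.ne)).2 (hadj i j hij hi)

/-- The join of an edge `ab` with the path `t - x - y - s` contracts onto `K₅` minus an edge. -/
lemma IsInducedMinor.not_P4_join_K2 {m : ℕ} (hm : 2 < m) (h : IsInducedMinor H (chain m))
    {a b x s t y : α} (hab : H.Adj a b) (hay : H.Adj a y) (hby : H.Adj b y) (has : H.Adj a s)
    (hbs : H.Adj b s) (hax : H.Adj a x) (hbx : H.Adj b x) (hat : a ≠ t) (hbt : b ≠ t)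
    (hys : H.Adj y s) (hyx : H.Adj y x) (hyt : y ≠ t) (htx : H.Adj t x) (hst : s ≠ t)
    (hsx : s ≠ x) : False := by
  obtain ⟨μ, -, h2, h3, h4⟩ := h
  have hc := fun a => isConn_of_connected (h3 a)
  have touch : ∀ {a b}, H.Adj a b → Touch (chain m) (μ a) (μ b) := fun {a b} hab =>
    (h4 a b hab.ne).2 hab
  have touchU : ∀ {a}, H.Adj a x → Touch (chain m) (μ a) (μ t ∪ μ x) := fun {a} hax => by
    obtain ⟨u, hu, v, hv, huv⟩ := touch hax
    exact ⟨u, hu, v, .inr hv, huv⟩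
  have disjU : ∀ {a}, a ≠ t → a ≠ x → Disjoint (μ a) (μ t ∪ μ x) := fun {a} ht hx =>
    Set.disjoint_union_right.2 ⟨h2 _ _ ht, h2 _ _ hx⟩
  refine (isChain_chain hm).not_K5_minus (T := ![μ a, μ b, μ y, μ s, μ t ∪ μ x]) ?_ ?_ ?_
  · intro i
    fin_cases i
    exacts [hc _, hc _, hc _, hc _, (hc t).union (hc x) (touch htx)]
  · intro i j hij
    wlog hlt : i < j generalizing i j
    · exact (this j i hij.symm (lt_of_le_of_ne (not_lt.1 hlt) hij.symm)).symm
    fin_cases i <;> fin_cases j <;> first | exact absurd hlt (by decide) | skip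
    exacts [h2 _ _ hab.ne, h2 _ _ hay.ne, h2 _ _ has.ne, disjU hat hax.ne, h2 _ _ hby.ne,
      h2 _ _ hbs.ne, disjU hbt hbx.ne, h2 _ _ hys.ne, disjU hyt hyx.ne, disjU hst hsx]
  · intro i j hlt hi
    fin_cases i <;> fin_cases j <;>
      first | exact absurd hlt (by decide) | exact absurd rfl hi | skip
    exacts [touch hab, touch hay, touch has, touchU hax, touch hby, touch hbs, touchU hbx,
      touch hys, touchU hyx]

/-- A split graph whose complement is triangle-free of maximum degree at most two is the
complement of an edgeless graph, a star or a path on four vertices, plus isolated vertices. -/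
lemma split_cases (K : Set α) (hK : ∀ a ∈ K, ∀ b ∈ K, a ≠ b → H.Adj a b)
    (hS : ∀ a ∉ K, ∀ b ∉ K, ¬ H.Adj a b)
    (tri : ∀ a b c, Hᶜ.Adj a b → Hᶜ.Adj b c → ¬ Hᶜ.Adj a c)
    (deg : ∀ v a b c, Hᶜ.Adj v a → Hᶜ.Adj v b → Hᶜ.Adj v c → a = b ∨ a = c ∨ b = c) :
    (∀ a b, ¬ Hᶜ.Adj a b) ∨
    (∃ v, (∃ u, Hᶜ.Adj v u) ∧ ∀ a b, Hᶜ.Adj a b → a = v ∨ b = v) ∨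
    ∃ x s t y, Hᶜ.Adj x s ∧ Hᶜ.Adj s t ∧ Hᶜ.Adj t y ∧ x ≠ t ∧ x ≠ y ∧ s ≠ y ∧
      ∀ a b, Hᶜ.Adj a b → s(a, b) = s(x, s) ∨ s(a, b) = s(s, t) ∨ s(a, b) = s(t, y) := by
  have cover : ∀ a b, Hᶜ.Adj a b → a ∉ K ∨ b ∉ K := by
    intro a b hab
    by_contra! h
    exact ((compl_adj _ _ _).1 hab).2 (hK a h.1 b h.2 hab.ne)
  have clique : ∀ a ∉ K, ∀ b ∉ K, a ≠ b → Hᶜ.Adj a b := fun a ha b hb hab =>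
    (compl_adj _ _ _).2 ⟨hab, hS a ha b hb⟩
  by_cases hE : ∀ a b, ¬ Hᶜ.Adj a b
  · exact .inl hE
  refine .inr ?_
  by_cases hstar : ∃ v, (∃ u, Hᶜ.Adj v u) ∧ ∀ a b, Hᶜ.Adj a b → a = v ∨ b = v
  · exact .inl hstar
  refine .inr ?_
  push Not at hE hstar
  -- an edge of the complement avoiding `v` has an endpoint outside `K`
  have avoid : ∀ v u, Hᶜ.Adj v u → ∃ a b, Hᶜ.Adj a b ∧ a ∉ K ∧ a ≠ v ∧ b ≠ v := by
    intro v u huv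
    obtain ⟨a, b, hab, hav, hbv⟩ := hstar v ⟨u, huv⟩
    rcases cover a b hab with h | h
    · exact ⟨a, b, hab, h, hav, hbv⟩
    · exact ⟨b, a, hab.symm, h, hbv, hav⟩
  obtain ⟨s, u, hsu, hs⟩ : ∃ s u, Hᶜ.Adj s u ∧ s ∉ K := by
    obtain ⟨a, b, hab⟩ := hE
    rcases cover a b hab with h | h
    · exact ⟨a, b, hab, h⟩
    · exact ⟨b, a, hab.symm, h⟩
  obtain ⟨t, y, hty, ht, hts, hys⟩ := avoid s u hsu
  have hst := clique s hs t ht hts.symm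
  have only : ∀ a ∉ K, a = s ∨ a = t := by
    intro a ha
    by_contra! h
    exact tri a s t (clique a ha s hs h.1) hst (clique a ha t ht h.2)
  obtain ⟨s', x, hsx, hs', hs't, hxt⟩ := avoid t y hty
  obtain rfl := (only s' hs').resolve_right hs't
  have hxy : x ≠ y := by
    rintro rfl
    exact tri _ _ _ hst hty hsx
  refine ⟨x, s', t, y, hsx.symm, hst, hty, hxt, hxy, hys.symm, ?_⟩
  have end_s : ∀ b, Hᶜ.Adj s' b → b = t ∨ b = x := fun b hb => by
    rcases deg s' b t x hb hst hsx with h | h | h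
    · exact .inl h
    · exact .inr h
    · exact absurd h.symm hxt
  have end_t : ∀ b, Hᶜ.Adj t b → b = s' ∨ b = y := fun b hb => by
    rcases deg t b s' y hb hst.symm hty with h | h | h
    · exact .inl h
    · exact .inr h
    · exact absurd h.symm hys
  have key : ∀ a b, Hᶜ.Adj a b → a ∉ K →
      s(a, b) = s(x, s') ∨ s(a, b) = s(s', t) ∨ s(a, b) = s(t, y) := by
    intro a b hab ha
    rcases only a ha with rfl | rfl
    · rcases end_s b hab with rfl | rfl
      · exact .inr (.inl rfl)
      · exact .inl Sym2.eq_swap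
    · rcases end_t b hab with rfl | rfl
      · exact .inr (.inl Sym2.eq_swap)
      · exact .inr (.inr rfl)
  intro a b hab
  rcases cover a b hab with h | h
  · exact key a b hab h
  · rw [Sym2.eq_swap]
    exact key b a hab.symm h

lemma hatK4_of_complete [Fintype α] {m : ℕ} (hm : 2 < m) (h : IsInducedMinor H (chain m))
    (hE : ∀ a b, ¬ Hᶜ.Adj a b) : IsInducedMinor H hatK4 := by
  have hH : ∀ a b, a ≠ b → H.Adj a b := fun a b hab => by
    by_contra hn
    exact hE a b ((compl_adj _ _ _).2 ⟨hab, hn⟩)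
  have hcard : Fintype.card α ≤ 4 := by
    by_contra! hlt
    obtain ⟨g⟩ : Nonempty (Fin 5 ↪ α) :=
      Function.Embedding.nonempty_of_card_le (by rw [Fintype.card_fin]; omega)
    exact h.not_K5_minus hm g g.injective fun i j hij _ => hH _ _ (g.injective.ne hij.ne)
  obtain ⟨g⟩ : Nonempty (α ↪ Fin 4) :=
    Function.Embedding.nonempty_of_card_le (by simpa using hcard)
  refine .of_injective (fun a => (g a).castSucc)
    ((Fin.castSucc_injective 4).comp g.injective) fun a b => ?_
  have h4 : ∀ a, (g a).castSucc ≠ (4 : Fin 5) := fun a => (g a).castSucc_lt_last.ne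
  rw [hatK4_adj]
  simp only [h4, false_and, not_false_eq_true, and_true, ne_eq, Fin.castSucc_inj,
    g.injective.eq_iff]
  exact ⟨hH a b, fun h => h.ne⟩

lemma hatK4_of_star [Fintype α] {m : ℕ} (hm : 2 < m) (h : IsInducedMinor H (chain m))
    (deg : ∀ v a b c, Hᶜ.Adj v a → Hᶜ.Adj v b → Hᶜ.Adj v c → a = b ∨ a = c ∨ b = c)
    {v u : α} (huv : Hᶜ.Adj v u) (hstar : ∀ a b, Hᶜ.Adj a b → a = v ∨ b = v) :
    IsInducedMinor H hatK4 := by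
  classical
  have hadj : ∀ a b, Hᶜ.Adj a b ↔ a ≠ b ∧ ¬ H.Adj a b := compl_adj H
  have hH : ∀ a b, a ≠ b → ¬ Hᶜ.Adj a b → H.Adj a b := fun a b hab hn => by
    by_contra hn'
    exact hn ((hadj a b).2 ⟨hab, hn'⟩)
  obtain ⟨g, hg⟩ := exists_injOn_fin (k := 2) two_pos ({a | Hᶜ.Adj v a} : Finset α) (by
    by_contra! hlt
    obtain ⟨a, ha, b, hb, c, hc, hab, hac, hbc⟩ := Finset.two_lt_card.1 hlt
    simp only [Finset.mem_filter_univ] at ha hb hc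
    rcases deg v a b c ha hb hc with h | h | h <;> contradiction)
  obtain ⟨k, hk⟩ := exists_injOn_fin (k := 2) two_pos ({a | a ≠ v ∧ ¬ Hᶜ.Adj v a} : Finset α) (by
    by_contra! hlt
    obtain ⟨a, ha, b, hb, c, hc, hab, hac, hbc⟩ := Finset.two_lt_card.1 hlt
    simp only [Finset.mem_filter_univ] at ha hb hc
    have full : ∀ d, d ≠ v → ¬ Hᶜ.Adj v d → ∀ e, d ≠ e → H.Adj d e := fun d h1 h2 e hde =>
      hH d e hde fun hde' => by
        rcases hstar d e hde' with rfl | rfl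
        · exact h1 rfl
        · exact h2 hde'.symm
    have hu : ∀ d, ¬ Hᶜ.Adj v d → d ≠ u := by
      rintro d hd rfl
      exact hd huv
    have key : ∀ i j : Fin 5, i < j → i ≠ 3 →
        H.Adj (![a, b, c, u, v] i) (![a, b, c, u, v] j) := by
      intro i j hlt hi
      fin_cases i <;> fin_cases j <;>
        first | exact absurd hlt (by decide) | exact absurd rfl hi | skip
      exacts [full a ha.1 ha.2 _ hab, full a ha.1 ha.2 _ hac, full a ha.1 ha.2 _ (hu a ha.2),
        full a ha.1 ha.2 _ ha.1, full b hb.1 hb.2 _ hbc, full b hb.1 hb.2 _ (hu b hb.2),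
        full b hb.1 hb.2 _ hb.1, full c hc.1 hc.2 _ (hu c hc.2), full c hc.1 hc.2 _ hc.1]
    refine h.not_K5_minus hm ![a, b, c, u, v] ?_ key
    intro i j hij
    by_contra hne
    wlog hlt : i < j generalizing i j
    · exact this hij.symm (Ne.symm hne) (lt_of_le_of_ne (not_lt.1 hlt) (Ne.symm hne))
    by_cases hi : i = 3
    · obtain rfl : j = 4 := by omega
      subst hi
      exact huv.ne hij.symm
    · exact (key i j hlt hi).ne hij)
  simp only [Set.InjOn, Finset.coe_filter, Finset.mem_univ, true_and, Set.mem_ofPred_eq] at hg hk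
  let f : α → Fin 5 := fun a =>
    if a = v then 4 else if Hᶜ.Adj v a then if g a = 0 then 2 else 3
    else if k a = 0 then 0 else 1
  have hg2 : ∀ a b, Hᶜ.Adj v a → Hᶜ.Adj v b → (g a = 0 ↔ g b = 0) → a = b :=
    fun a b ha hb hab => hg ha hb (by omega)
  have hk2 : ∀ a b, a ≠ v → ¬ Hᶜ.Adj v a → b ≠ v → ¬ Hᶜ.Adj v b → (k a = 0 ↔ k b = 0) → a = b :=
    fun a b h1 h2 h3 h4 hab => hk ⟨h1, h2⟩ ⟨h3, h4⟩ (by omega)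
  have fv : f v = 4 := if_pos rfl
  have fN : ∀ a, Hᶜ.Adj v a → f a = if g a = 0 then 2 else 3 := fun a ha => by
    simp only [f, if_neg ha.ne', if_pos ha]
  have fO : ∀ a, a ≠ v → ¬ Hᶜ.Adj v a → f a = if k a = 0 then 0 else 1 := fun a h1 h2 => by
    simp only [f, if_neg h1, if_neg h2]
  clear_value f
  have hval : ∀ {c}, f c = 4 ↔ c = v := by
    intro c
    by_cases hc : c = v
    · simp [hc, fv]
    by_cases hvc : Hᶜ.Adj v c
    · rw [fN c hvc]; split_ifs <;> simp [hc]
    · rw [fO c hc hvc]; split_ifs <;> simp [hc]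
  have hval' : ∀ {c}, (f c = 2 ∨ f c = 3) ↔ Hᶜ.Adj v c := by
    intro c
    by_cases hc : c = v
    · simp [hc, fv]
    by_cases hvc : Hᶜ.Adj v c
    · rw [fN c hvc]; split_ifs <;> simp only [hvc] <;> decide
    · rw [fO c hc hvc]; split_ifs <;> simp only [hvc] <;> decide
  have hinj : Function.Injective f := by
    intro a b hab
    by_cases ha : a = v
    · rw [ha, hval.2 rfl, eq_comm, hval] at hab
      rw [ha, hab]
    by_cases hb : b = v
    · rw [hb, hval.2 rfl, hval] at hab
      rw [hb, hab]
    have hiff : Hᶜ.Adj v a ↔ Hᶜ.Adj v b := by rw [← hval', ← hval', hab]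
    by_cases hva : Hᶜ.Adj v a
    · have hvb := hiff.1 hva
      refine hg2 a b hva hvb ?_
      rw [fN a hva, fN b hvb] at hab
      split_ifs at hab with h1 h2 h2
      · exact iff_of_true h1 h2
      · exact absurd hab (by decide)
      · exact absurd hab (by decide)
      · exact iff_of_false h1 h2
    · have hvb := mt hiff.2 hva
      refine hk2 a b ha hva hb hvb ?_
      rw [fO a ha hva, fO b hb hvb] at hab
      split_ifs at hab with h1 h2 h2
      · exact iff_of_true h1 h2
      · exact absurd hab (by decide)
      · exact absurd hab (by decide)
      · exact iff_of_false h1 h2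
  refine .of_injective f hinj fun a b => ?_
  rw [hatK4_adj, hinj.ne_iff]
  by_cases hab : a = b
  · simp [hab]
  have hcomm : Hᶜ.Adj a b ↔ (a = v ∧ Hᶜ.Adj v b) ∨ (b = v ∧ Hᶜ.Adj v a) := by
    constructor
    · intro h
      rcases hstar a b h with rfl | rfl
      · exact .inl ⟨rfl, h⟩
      · exact .inr ⟨rfl, h.symm⟩
    · rintro (⟨rfl, h⟩ | ⟨rfl, h⟩)
      exacts [h, h.symm]
  have : H.Adj a b ↔ ¬ Hᶜ.Adj a b := by rw [hadj]; tauto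
  rw [hval, hval, hval', hval', this, hcomm]
  tauto

lemma gem_of_path {m : ℕ} (hm : 2 < m) (h : IsInducedMinor H (chain m)) {x s t y : α}
    (hxs : Hᶜ.Adj x s) (hst : Hᶜ.Adj s t) (hty : Hᶜ.Adj t y) (hxt : x ≠ t) (hxy : x ≠ y)
    (hsy : s ≠ y) (hE : ∀ a b, Hᶜ.Adj a b →
      s(a, b) = s(x, s) ∨ s(a, b) = s(s, t) ∨ s(a, b) = s(t, y)) :
    IsInducedMinor H gem := by
  classical
  have n1 := hxs.ne
  have n2 := hst.ne
  have n3 := hty.ne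
  have hC : ∀ a b, a ≠ b → (H.Adj a b ↔ ¬ ((a = x ∧ b = s) ∨ (a = s ∧ b = x) ∨
      (a = s ∧ b = t) ∨ (a = t ∧ b = s) ∨ (a = t ∧ b = y) ∨ (a = y ∧ b = t))) := by
    intro a b hab
    have h1 : H.Adj a b ↔ ¬ Hᶜ.Adj a b := by rw [compl_adj]; tauto
    rw [h1, not_iff_not]
    constructor
    · intro h
      simpa only [Sym2.eq_iff, or_assoc] using hE a b h
    · rintro (⟨rfl, rfl⟩ | ⟨rfl, rfl⟩ | ⟨rfl, rfl⟩ | ⟨rfl, rfl⟩ | ⟨rfl, rfl⟩ | ⟨rfl, rfl⟩)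
      exacts [hxs, hxs.symm, hst, hst.symm, hty, hty.symm]
  have one : ∀ a b, a ≠ x → a ≠ s → a ≠ t → a ≠ y → b ≠ x → b ≠ s → b ≠ t → b ≠ y → a = b := by
    intro a b a1 a2 a3 a4 b1 b2 b3 b4
    by_contra hab
    have full : ∀ d, d ≠ x → d ≠ s → d ≠ t → d ≠ y → ∀ e, d ≠ e → H.Adj d e := by
      intro d d1 d2 d3 d4 e hde
      rw [hC d e hde]
      simp only [d1, d2, d3, d4, false_and, or_self, not_false_eq_true]
    have ha := full a a1 a2 a3 a4
    have hb := full b b1 b2 b3 b4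
    refine h.not_P4_join_K2 hm (a := a) (b := b) (x := x) (s := s) (t := t) (y := y)
      (ha b hab) (ha y a4) (hb y b4) (ha s a2) (hb s b2) (ha x a1) (hb x b1) a3 b3
      ((hC _ _ hsy.symm).2 ?_) ((hC _ _ hxy.symm).2 ?_) n3.symm ((hC _ _ hxt.symm).2 ?_)
      n2 n1.symm <;> grind
  let f : α → Fin 5 := fun a =>
    if a = x then 2 else if a = s then 0 else if a = t then 3 else if a = y then 1 else 4
  have hf : ∀ a, (f a = 2 ↔ a = x) ∧ (f a = 0 ↔ a = s) ∧ (f a = 3 ↔ a = t) ∧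
      (f a = 1 ↔ a = y) ∧ (f a = 4 ↔ (a ≠ x ∧ a ≠ s ∧ a ≠ t ∧ a ≠ y)) := by
    intro a
    simp only [f]
    grind
  clear_value f
  have hinj : Function.Injective f := by
    intro a b hab
    have ha := hf a
    have hb := hf b
    have := one a b
    rw [hab] at ha
    have hval : f b = 0 ∨ f b = 1 ∨ f b = 2 ∨ f b = 3 ∨ f b = 4 := by omega
    grind
  refine .of_injective f hinj fun a b => ?_
  rw [gem_adj, hinj.ne_iff]
  by_cases hab : a = b
  · simp [hab]
  rw [hC a b hab]
  obtain ⟨a1, a2, a3, a4, -⟩ := hf a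
  obtain ⟨b1, b2, b3, b4, -⟩ := hf b
  rw [a1, a2, a3, a4, b1, b2, b3, b4]
  clear * - hab
  grind

end Classification

/-- If `Excl(H)` is wqo by induced minors, then `H` is an induced minor of `K̂₄`
or of the gem. -/
theorem wqo_implies_inducedMinor_hatK4_or_gem {α : Type*} [Fintype α]
    (H : SimpleGraph α)
    (h : WqoClass (fun G => ¬ IsInducedMinor H G.2)) :
    IsInducedMinor H hatK4 ∨ IsInducedMinor H gem := by
  obtain ⟨i, hi⟩ := exists_inducedMinor_of_wqo h (fun i => ZMod (i + 4))
    (fun i => (cyc (i + 4))ᶜ) fun i j hij => antihole_bad (by omega) (by omega)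
  obtain ⟨j, hj⟩ := exists_inducedMinor_of_wqo h (fun i => ZMod (i + 5) ⊕ ZMod (i + 5))
    (fun i => coSun (i + 5)) fun i j hij => coSun_bad (by omega) (by omega)
  obtain ⟨k, hk⟩ := exists_inducedMinor_of_wqo h (fun i => ChainVertex (i + 6))
    (fun i => chain (i + 6)) fun i j hij => chain_bad (by omega) (by omega)
  obtain ⟨f, hf, hadj⟩ := hi.exists_injective_of_compl
  obtain ⟨K, hK, hS⟩ := hj.isSplit
  have hcyc : ∀ a b, Hᶜ.Adj a b → f b = f a + 1 ∨ f b = f a - 1 := fun a b hab =>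
    cyc_adj (hadj a b hab.ne ((compl_adj _ _ _).1 hab).2)
  have deg : ∀ v a b c, Hᶜ.Adj v a → Hᶜ.Adj v b → Hᶜ.Adj v c → a = b ∨ a = c ∨ b = c := by
    intro v a b c ha hb hc
    have h1 := hcyc v a ha
    have h2 := hcyc v b hb
    have h3 := hcyc v c hc
    grind [Function.Injective]
  have tri : ∀ a b c, Hᶜ.Adj a b → Hᶜ.Adj b c → ¬ Hᶜ.Adj a c := by
    intro a b c hab hbc hac
    have h1 := hcyc a b hab
    have h2 := hcyc a c hac
    have h3 := hcyc b c hbc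
    have one := ZMod.natCast_ne_zero_of_lt (n := i + 4) 1 (by omega) (by omega)
    have three := ZMod.natCast_ne_zero_of_lt (n := i + 4) 3 (by omega) (by omega)
    push_cast at one three
    have hne := hf.ne hbc.ne
    rcases h1 with h1 | h1 <;> rcases h2 with h2 | h2 <;> rcases h3 with h3 | h3
    · exact hne (h1.trans h2.symm)
    · exact hne (h1.trans h2.symm)
    · exact three (by linear_combination h2 - h3 - h1)
    · exact one (by linear_combination h2 - h3 - h1)
    · exact one (by linear_combination h1 - h2 + h3)
    · exact three (by linear_combination h3 + h1 - h2)
    · exact hne (h1.trans h2.symm)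
    · exact hne (h1.trans h2.symm)
  rcases split_cases K hK hS tri deg with hE | ⟨v, ⟨u, huv⟩, hstar⟩ |
    ⟨x, s, t, y, hxs, hst, hty, hxt, hxy, hsy, hE⟩
  · exact .inl (hatK4_of_complete (by omega) hk hE)
  · exact .inl (hatK4_of_star (by omega) hk deg huv hstar)
  · exact .inr (gem_of_path (by omega) hk hxs hst hty hxt hxy hsy hE)

end IMWQO
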